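/- arXiv:2012.03361 — 2 statements merged into one kernel-verified Lean document; each statement's English description precedes it below -/
import Mathlib

section
/- Let (R, m_R) be a local ring and N_1, ..., N_n strongly Tor-independent R-modules with first syzygies N_1', ..., N_n'. Then N_1', ..., N_n' are strongly Tor-independent, and for each subset I ⊆ {1,...,n} the tensor product ⊗_{i∈I} N_i' embeds in a finitely generated free R-module. -/
universe u

open CategoryTheory

/-- The iterated tensor product `N j₁ ⊗ ⋯ ⊗ N jₜ` of a family of modules along a list
of indices (the empty tensor product being `R`). -/
noncomputable def tensorList (R : Type u) [CommRing R] {n : ℕ}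
    (N : Fin n → ModuleCat.{u} R) : List (Fin n) → ModuleCat.{u} R
  | [] => ModuleCat.of R R
  | j :: l => MonoidalCategory.tensorObj (N j) (tensorList R N l)

/-- A family `N` of `R`-modules is strongly Tor-independent if
`Tor_i(N j₁ ⊗ ⋯ ⊗ N jₜ, N j_{t+1}) = 0` for all `i ≥ 1` and all distinct indices
`j₁, …, j_{t+1}` with `t ≥ 1`. -/
def StronglyTorIndependent (R : Type u) [CommRing R] {n : ℕ}
    (N : Fin n → ModuleCat.{u} R) : Prop :=
  ∀ l : List (Fin n), l.Nodup → l ≠ [] → ∀ j : Fin n, j ∉ l → ∀ i : ℕ, 1 ≤ i →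
    Limits.IsZero (((Tor (ModuleCat.{u} R) i).obj (tensorList R N l)).obj (N j))

/-- The minimal number of generators `μ(m_R)` of the maximal ideal of a local ring. -/
noncomputable def spanMu (R : Type u) [CommRing R] [IsLocalRing R] : ℕ :=
  sInf {k | ∃ s : Finset R, s.card = k ∧
    Ideal.span (s : Set R) = IsLocalRing.maximalIdeal R}

/-- `l` is a regular sequence on `R`: each entry is a nonzerodivisor modulo the ideal
generated by the preceding entries. -/
def IsRegSeq (R : Type u) [CommRing R] (l : List R) : Prop :=
  ∀ (i : ℕ) (h : i < l.length), ∀ r : R,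
    l.get ⟨i, h⟩ * r ∈ Ideal.span {x | x ∈ l.take i} →
      r ∈ Ideal.span {x | x ∈ l.take i}

/-- The depth of a local ring: the supremum of lengths of regular sequences contained
in the maximal ideal. -/
noncomputable def ringDepth (R : Type u) [CommRing R] [IsLocalRing R] : ℕ :=
  sSup {k | ∃ l : List R, l.length = k ∧
    (∀ x ∈ l, x ∈ IsLocalRing.maximalIdeal R) ∧ IsRegSeq R l}

/-- The embedding codepth `ecodepth(R) = μ(m_R) - depth(R)`. -/
noncomputable def ecodepth (R : Type u) [CommRing R] [IsLocalRing R] : ℕ :=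
  spanMu R - ringDepth R

namespace TorAux
open Limits

variable {R : Type u} [CommRing R]

theorem tor_iff (A : ModuleCat.{u} R) {B : ModuleCat.{u} R} (P : ProjectiveResolution B) (i : ℕ) :
    IsZero (((Tor (ModuleCat.{u} R) (i+1)).obj A).obj B) ↔
      Function.Exact ((P.complex.d (i+2) (i+1)).hom.lTensor A)
        ((P.complex.d (i+1) i).hom.lTensor A) := by
  have e := P.isoLeftDerivedObj ((MonoidalCategory.tensoringLeft (ModuleCat.{u} R)).obj A) (i+1)
  have h1 : IsZero (((Tor (ModuleCat.{u} R) (i+1)).obj A).obj B) ↔ _ := e.isZero_iff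
  rw [h1]
  have h2 := HomologicalComplex.exactAt_iff_isZero_homology
    ((((MonoidalCategory.tensoringLeft (ModuleCat.{u} R)).obj A).mapHomologicalComplex
      (ComplexShape.down ℕ)).obj P.complex) (i+1)
  refine h2.symm.trans ?_
  rw [HomologicalComplex.exactAt_iff' _ (i+2) (i+1) i (by simp) (by simp),
    ShortComplex.ShortExact.moduleCat_exact_iff_function_exact]
  exact Iff.rfl

theorem res_data {K : ModuleCat.{u} R} (P : ProjectiveResolution K) :
    ∃ ε : P.complex.X 0 ⟶ K, Function.Surjective ε.hom ∧
      Function.Exact (P.complex.d 1 0).hom ε.hom := by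
  refine ⟨P.π.f 0, ?_, ?_⟩
  · exact (ModuleCat.epi_iff_surjective (P.π.f 0)).1 inferInstance
  · exact (ShortComplex.ShortExact.moduleCat_exact_iff_function_exact _).1 P.exact₀

theorem res_exact {K : ModuleCat.{u} R} (P : ProjectiveResolution K) (i : ℕ) :
    Function.Exact (P.complex.d (i+2) (i+1)).hom (P.complex.d (i+1) i).hom :=
  (ShortComplex.ShortExact.moduleCat_exact_iff_function_exact _).1 (P.exact_succ i)

theorem res_flat {K : ModuleCat.{u} R} (P : ProjectiveResolution K) (i : ℕ) :
    Module.Flat R (P.complex.X i) := by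
  have : Module.Projective R (P.complex.X i) :=
    (IsProjective.iff_projective (P.complex.X i)).2 (P.projective i)
  infer_instance

/-- Splicing a resolution with a projective module in degree zero. -/
theorem splice {F B : ModuleCat.{u} R} (C : ChainComplex (ModuleCat.{u} R) ℕ)
    (hC : ∀ i, Projective (C.X i))
    (hCe : ∀ i, Function.Exact (C.d (i+2) (i+1)).hom (C.d (i+1) i).hom)
    (ε : C.X 0 ⟶ F) (g : F ⟶ B) [Projective F] (hw : C.d 1 0 ≫ ε = 0)
    (hε : Function.Exact (C.d 1 0).hom ε.hom) (hg : Function.Exact ε.hom g.hom)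
    (hs : Function.Surjective g.hom) :
    ∃ Q : ProjectiveResolution B, Q.complex = C.augment ε hw := by
  have w : ε ≫ g = 0 := by
    ext x
    exact hg.apply_apply_eq_zero x
  refine ⟨{ complex := C.augment ε hw
            projective := ?_
            π := (ChainComplex.toSingle₀Equiv _ _).symm ⟨g, w⟩
            quasiIso := ⟨fun n => ?_⟩ }, rfl⟩
  · intro n
    cases n with
    | zero => exact inferInstanceAs (Projective F)
    | succ n => exact hC n
  · cases n with
    | zero =>
      rw [ChainComplex.quasiIsoAt₀_iff, ShortComplex.quasiIso_iff_of_zeros']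
      · have hep : Epi g := (ModuleCat.epi_iff_surjective g).2 hs
        have hex : (ShortComplex.mk ε g w).Exact :=
          (ShortComplex.ShortExact.moduleCat_exact_iff_function_exact _).2 hg
        exact ⟨hex, hep⟩
      all_goals rfl
    | succ n =>
      rw [quasiIsoAt_iff_exactAt']
      · rw [HomologicalComplex.exactAt_iff' _ (n+2) (n+1) n (by simp) (by simp),
          ShortComplex.ShortExact.moduleCat_exact_iff_function_exact]
        cases n with
        | zero => exact hε
        | succ n => exact hCe n
      · apply ChainComplex.exactAt_succ_single_obj

/-- Dimension shifting in the second variable. -/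
theorem shift (A : ModuleCat.{u} R) {K F B : ModuleCat.{u} R} [Projective F]
    (f : K →ₗ[R] F) (g : F →ₗ[R] B) (hf : Function.Injective f) (hfg : Function.Exact f g)
    (hg : Function.Surjective g) :
    (IsZero (((Tor (ModuleCat.{u} R) 1).obj A).obj B) → Function.Injective (f.lTensor A)) ∧
    ∀ i, IsZero (((Tor (ModuleCat.{u} R) (i+2)).obj A).obj B) →
      IsZero (((Tor (ModuleCat.{u} R) (i+1)).obj A).obj K) := by
  obtain ⟨P⟩ : Nonempty (ProjectiveResolution K) := ⟨ProjectiveResolution.of K⟩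
  obtain ⟨ε, hεs, hεe⟩ := res_data P
  have hw : P.complex.d 1 0 ≫ (ε ≫ ModuleCat.ofHom f) = 0 := by
    ext x
    have := hεe.apply_apply_eq_zero x
    simp [this]
  obtain ⟨Q, hQ⟩ := splice P.complex P.projective (res_exact P) (ε ≫ ModuleCat.ofHom f)
    (ModuleCat.ofHom g) hw
    (by
      intro x
      rw [← hεe x]
      change f (ε.hom x) = 0 ↔ _
      exact map_eq_zero_iff f hf)
    (by
      intro x
      refine (hfg x).trans ⟨?_, ?_⟩
      · rintro ⟨y, rfl⟩
        obtain ⟨z, rfl⟩ := hεs y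
        exact ⟨z, rfl⟩
      · rintro ⟨z, rfl⟩
        exact ⟨ε.hom z, rfl⟩) hg
  obtain ⟨Qc, Qp, Qπ, Qq⟩ := Q
  dsimp only at hQ
  subst hQ
  constructor
  · intro h
    rw [tor_iff A ⟨_, Qp, Qπ, Qq⟩ 0] at h
    have h' : Function.Exact ((P.complex.d 1 0).hom.lTensor A) ((f ∘ₗ ε.hom).lTensor A) := h
    rw [injective_iff_map_eq_zero]
    intro x hx
    obtain ⟨y, rfl⟩ := LinearMap.lTensor_surjective A hεs x
    rw [← LinearMap.comp_apply, ← LinearMap.lTensor_comp] at hx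
    obtain ⟨z, rfl⟩ := (h' y).1 hx
    rw [← LinearMap.comp_apply, ← LinearMap.lTensor_comp, hεe.linearMap_comp_eq_zero]
    simp
  · intro i h
    rw [tor_iff A ⟨_, Qp, Qπ, Qq⟩ (i+1)] at h
    rw [tor_iff A P]
    exact h

/-- Flat modules have no higher Tor. -/
theorem tor_flat (A B : ModuleCat.{u} R) [Module.Flat R A] (i : ℕ) :
    IsZero (((Tor (ModuleCat.{u} R) (i+1)).obj A).obj B) := by
  rw [tor_iff A (ProjectiveResolution.of B)]
  exact Module.Flat.lTensor_exact A (res_exact _ i)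

theorem tor_flat_tensor (F A B : ModuleCat.{u} R) [Module.Flat R F] (i : ℕ)
    (h : IsZero (((Tor (ModuleCat.{u} R) (i+1)).obj A).obj B)) :
    IsZero (((Tor (ModuleCat.{u} R) (i+1)).obj (ModuleCat.of R (TensorProduct R F A))).obj B) := by
  rw [tor_iff _ (ProjectiveResolution.of B)] at h ⊢
  have h2 := Module.Flat.lTensor_exact F h
  refine (Function.Exact.iff_of_ladder_linearEquiv
    (e₁ := TensorProduct.assoc R F A _) (e₂ := TensorProduct.assoc R F A _)
    (e₃ := TensorProduct.assoc R F A _) ?_ ?_).1 h2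
  · ext; rfl
  · ext; rfl

/-- The long exact sequence in the first variable. -/
theorem tor_first {X Y Z B : ModuleCat.{u} R} (f : X →ₗ[R] Y) (g : Y →ₗ[R] Z)
    (hf : Function.Injective f) (hfg : Function.Exact f g) (hg : Function.Surjective g) (i : ℕ)
    (hY : IsZero (((Tor (ModuleCat.{u} R) (i+1)).obj Y).obj B))
    (hZ : IsZero (((Tor (ModuleCat.{u} R) (i+2)).obj Z).obj B)) :
    IsZero (((Tor (ModuleCat.{u} R) (i+1)).obj X).obj B) := by
  have P := ProjectiveResolution.of B
  have fl := res_flat P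
  rw [tor_iff _ P] at hY hZ ⊢
  have comm : ∀ {U V : ModuleCat.{u} R} (h : U →ₗ[R] V) (a b : ℕ) (x : TensorProduct R U (P.complex.X a)),
      h.rTensor (P.complex.X b) ((P.complex.d a b).hom.lTensor U x) =
        (P.complex.d a b).hom.lTensor V (h.rTensor (P.complex.X a) x) := by
    intro U V h a b x
    rw [← LinearMap.comp_apply, ← LinearMap.comp_apply, LinearMap.rTensor_comp_lTensor,
      LinearMap.lTensor_comp_rTensor]
  have inj : ∀ a, Function.Injective (f.rTensor (P.complex.X a)) := fun a =>
    Module.Flat.rTensor_preserves_injective_linearMap f hf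
  have dd : ∀ (U : ModuleCat.{u} R) (a) (x : TensorProduct R U (P.complex.X (a+2))),
      (P.complex.d (a+1) a).hom.lTensor U ((P.complex.d (a+2) (a+1)).hom.lTensor U x) = 0 := by
    intro U a x
    rw [← LinearMap.comp_apply, ← LinearMap.lTensor_comp,
      (res_exact P a).linearMap_comp_eq_zero]
    simp
  intro x
  constructor
  · intro hx
    obtain ⟨y, hy⟩ := (hY (f.rTensor _ x)).1 (by rw [← comm, hx, map_zero])
    obtain ⟨z, hz⟩ := (hZ (g.rTensor _ y)).1 (by
      rw [← comm, hy, ← LinearMap.comp_apply, ← LinearMap.rTensor_comp,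
        hfg.linearMap_comp_eq_zero]
      simp)
    obtain ⟨y', rfl⟩ := LinearMap.rTensor_surjective _ hg z
    rw [← comm] at hz
    obtain ⟨x', hx'⟩ := (rTensor_exact (P.complex.X (i+2)) hfg hg
      (y - (P.complex.d (i+3) (i+2)).hom.lTensor Y y')).1 (by rw [map_sub, hz, sub_self])
    refine ⟨x', inj _ ?_⟩
    rw [comm, hx', map_sub, hy, dd, sub_zero]
  · rintro ⟨x', rfl⟩
    exact dd _ _ _

end TorAux
namespace TorAux
open Limits MonoidalCategory

variable {R : Type u} [CommRing R] {n : ℕ}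

/-- All higher Tor modules vanish. -/
def TZ (A B : ModuleCat.{u} R) : Prop :=
  ∀ i : ℕ, IsZero (((Tor (ModuleCat.{u} R) (i+1)).obj A).obj B)

theorem TZ.of_iso {A A' B : ModuleCat.{u} R} (e : Nonempty (A ≅ A')) (h : TZ A B) : TZ A' B := by
  obtain ⟨e⟩ := e
  intro i
  exact (h i).of_iso ((((Tor (ModuleCat.{u} R) (i+1)).mapIso e).app B).symm)

theorem tensorList_congr (M M' : Fin n → ModuleCat.{u} R) (l : List (Fin n))
    (h : ∀ i ∈ l, M i = M' i) : tensorList R M l = tensorList R M' l := by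
  induction l with
  | nil => rfl
  | cons a l ih =>
    simp only [tensorList]
    rw [h a (by simp), ih (fun i hi => h i (by simp [hi]))]

theorem tensorList_perm (M : Fin n → ModuleCat.{u} R) {l l' : List (Fin n)} (h : l.Perm l') :
    Nonempty (tensorList R M l ≅ tensorList R M l') := by
  induction h with
  | nil => exact ⟨Iso.refl _⟩
  | cons a _ ih => exact ⟨whiskerLeftIso (M a) ih.some⟩
  | swap a b l =>
    exact ⟨(α_ (M b) (M a) (tensorList R M l)).symm ≪≫
      whiskerRightIso (β_ (M b) (M a)) (tensorList R M l) ≪≫ α_ (M a) (M b) (tensorList R M l)⟩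
  | trans _ _ ih1 ih2 => exact ⟨ih1.some ≪≫ ih2.some⟩

theorem sti_iff (M : Fin n → ModuleCat.{u} R) :
    StronglyTorIndependent R M ↔
      ∀ l : List (Fin n), l.Nodup → ∀ j, j ∉ l → TZ (tensorList R M l) (M j) := by
  constructor
  · intro h l hl j hj i
    by_cases h0 : l = []
    · subst h0
      have : Module.Flat R (tensorList R M []) := inferInstanceAs (Module.Flat R R)
      exact tor_flat _ _ _
    · exact h l hl h0 j hj (i+1) (by omega)
  · intro h l hl _ j hj i hi
    obtain ⟨i, rfl⟩ : ∃ k, i = k + 1 := ⟨i - 1, by omega⟩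
    exact h l hl j hj i

/-- Short exact presentation by a finite free module. -/
def Syz (K B : ModuleCat.{u} R) : Prop :=
  ∃ (c : ℕ) (f : K →ₗ[R] (Fin c → R)) (g : (Fin c → R) →ₗ[R] B),
    Function.Injective f ∧ Function.Exact f g ∧ Function.Surjective g

theorem step (M M' : Fin n → ModuleCat.{u} R) (a : Fin n) (hM : ∀ i, i ≠ a → M' i = M i)
    (hs : Syz (M' a) (M a)) (h : StronglyTorIndependent R M) : StronglyTorIndependent R M' := by
  rw [sti_iff] at h ⊢
  obtain ⟨c, f, g, hf, hfg, hg⟩ := hs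
  have hproj : Projective (ModuleCat.of R (Fin c → R)) :=
    (IsProjective.iff_projective (ModuleCat.of R (Fin c → R))).1
      (inferInstanceAs (Module.Projective R (Fin c → R)))
  intro l hl j hj
  by_cases hal : a ∈ l
  · have hja : j ≠ a := by rintro rfl; exact hj hal
    have hp := List.perm_cons_erase hal
    have hnd := hp.nodup_iff.1 hl
    rw [List.nodup_cons] at hnd
    obtain ⟨hal', hl'⟩ := hnd
    have hjl' : j ∉ l.erase a := fun hh => hj (List.mem_of_mem_erase hh)
    refine TZ.of_iso (Nonempty.map Iso.symm (tensorList_perm M' hp)) ?_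
    rw [hM j hja]
    have hc : tensorList R M' (l.erase a) = tensorList R M (l.erase a) :=
      tensorList_congr _ _ _ (fun i hi => hM i (by rintro rfl; exact hal' hi))
    change TZ (M' a ⊗ tensorList R M' (l.erase a)) (M j)
    rw [hc]
    set A := tensorList R M (l.erase a) with hA
    have h1 := (shift A (F := ModuleCat.of R (Fin c → R)) f g hf hfg hg).1
      (h _ hl' a hal' 0)
    have h1' : Function.Injective (f.rTensor A) :=
      (LinearMap.lTensor_inj_iff_rTensor_inj A f).1 h1
    intro i
    refine tor_first (X := M' a ⊗ A) (Y := ModuleCat.of R (TensorProduct R (Fin c → R) A))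
      (Z := M a ⊗ A) (f.rTensor A) (g.rTensor A) h1' (rTensor_exact A hfg hg)
      (LinearMap.rTensor_surjective A hg) i ?_ ?_
    · have : Module.Flat R (ModuleCat.of R (Fin c → R)) :=
        inferInstanceAs (Module.Flat R (Fin c → R))
      exact tor_flat_tensor (ModuleCat.of R (Fin c → R)) A (M j) i (h _ hl' j hjl' i)
    · exact h (a :: l.erase a) (List.nodup_cons.2 ⟨hal', hl'⟩) j
        (by simp [hja, hjl']) (i+1)
  · rw [tensorList_congr M' M l (fun i hi => hM i (by rintro rfl; exact hal hi))]
    by_cases hja : j = a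
    · subst hja
      intro i
      exact (shift _ (F := ModuleCat.of R (Fin c → R)) f g hf hfg hg).2 i (h l hl j hj (i+1))
    · rw [hM j hja]
      exact h l hl j hj

/-- Mixed family. -/
noncomputable def mix (N K : Fin n → ModuleCat.{u} R) (S : Finset (Fin n)) (i : Fin n) :
    ModuleCat.{u} R := if i ∈ S then K i else N i

theorem mix_sti (N K : Fin n → ModuleCat.{u} R) (hs : ∀ i, Syz (K i) (N i))
    (h : StronglyTorIndependent R N) (S : Finset (Fin n)) :
    StronglyTorIndependent R (mix N K S) := by
  induction S using Finset.induction_on with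
  | empty =>
    have : mix N K ∅ = N := by funext i; simp [mix]
    rwa [this]
  | insert a S ha ih =>
    refine step _ _ a ?_ ?_ ih
    · intro i hi; simp [mix, hi]
    · have h1 : mix N K (insert a S) a = K a := by simp [mix]
      have h2 : mix N K S a = N a := by simp [mix, ha]
      rw [h1, h2]
      exact hs a

theorem embed (N K : Fin n → ModuleCat.{u} R) (hs : ∀ i, Syz (K i) (N i))
    (h : StronglyTorIndependent R N) (l : List (Fin n)) (hl : l.Nodup) :
    ∃ (m : ℕ) (ψ : tensorList R K l →ₗ[R] (Fin m → R)), Function.Injective ψ := by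
  induction l with
  | nil =>
    refine ⟨1, LinearMap.pi (fun _ => (LinearMap.id : R →ₗ[R] R)), ?_⟩
    intro x y hxy
    exact congrFun hxy 0
  | cons a l ih =>
    rw [List.nodup_cons] at hl
    obtain ⟨m, ψ, hψ⟩ := ih hl.2
    have h1 := (sti_iff _).1 (mix_sti N K hs h (Finset.univ.erase a)) l hl.2 a hl.1 0
    rw [tensorList_congr _ K l
      (fun i hi => by
        have : i ≠ a := by rintro rfl; exact hl.1 hi
        simp [mix, this])] at h1
    have h2 : mix N K (Finset.univ.erase a) a = N a := by simp [mix]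
    rw [h2] at h1
    obtain ⟨c, f, g, hf, hfg, hg⟩ := hs a
    have hproj : Projective (ModuleCat.of R (Fin c → R)) :=
      (IsProjective.iff_projective (ModuleCat.of R (Fin c → R))).1
        (inferInstanceAs (Module.Projective R (Fin c → R)))
    have h3 := (shift _ (F := ModuleCat.of R (Fin c → R)) f g hf hfg hg).1 h1
    have h3' : Function.Injective (f.rTensor (tensorList R K l)) :=
      (LinearMap.lTensor_inj_iff_rTensor_inj _ f).1 h3
    have h4 : Function.Injective (ψ.lTensor (Fin c → R)) :=
      Module.Flat.lTensor_preserves_injective_linearMap ψ hψ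
    let e : TensorProduct R (Fin c → R) (Fin m → R) ≃ₗ[R] (Fin (c * m) → R) :=
      ((Pi.basisFun R (Fin c)).tensorProduct (Pi.basisFun R (Fin m))).equivFun.trans
        (LinearEquiv.funCongrLeft R R finProdFinEquiv.symm)
    exact ⟨c * m, e.toLinearMap ∘ₗ ψ.lTensor (Fin c → R) ∘ₗ f.rTensor (tensorList R K l),
      e.injective.comp (h4.comp h3')⟩

end TorAux

/-- Let `(R, m_R)` be a local ring and `N 0, …, N (n-1)` strongly
Tor-independent finitely generated `R`-modules with first syzygies `N' i` (kernels of
surjections from finitely generated free modules).  Then `N' 0, …, N' (n-1)` are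
strongly Tor-independent, and every sub-tensor-product `⊗_{i ∈ I} N' i` embeds in a
finitely generated free `R`-module. -/
theorem stmt14 (R : Type u) [CommRing R] [IsNoetherianRing R] [IsLocalRing R]
    (n : ℕ) (N : Fin n → ModuleCat.{u} R)
    (hfg : ∀ i, Module.Finite R (N i))
    (hTI : StronglyTorIndependent R N)
    (c : Fin n → ℕ) (φ : ∀ i, (Fin (c i) → R) →ₗ[R] N i)
    (hφ : ∀ i, Function.Surjective (φ i)) :
    StronglyTorIndependent R (fun i => ModuleCat.of R (LinearMap.ker (φ i))) ∧
      ∀ l : List (Fin n), l.Nodup →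
        ∃ (m : ℕ) (ψ : tensorList R (fun i => ModuleCat.of R (LinearMap.ker (φ i))) l
            →ₗ[R] (Fin m → R)), Function.Injective ψ := by
  have hs : ∀ i, TorAux.Syz (ModuleCat.of R (LinearMap.ker (φ i))) (N i) := fun i =>
    ⟨c i, (LinearMap.ker (φ i)).subtype, φ i, Subtype.val_injective,
      LinearMap.exact_subtype_ker_map (φ i), hφ i⟩
  refine ⟨?_, fun l hl => TorAux.embed N _ hs hTI l hl⟩
  have h := TorAux.mix_sti N _ hs hTI Finset.univ
  have e : TorAux.mix N (fun i => ModuleCat.of R (LinearMap.ker (φ i))) Finset.univ =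
      fun i => ModuleCat.of R (LinearMap.ker (φ i)) := by
    funext i; simp [TorAux.mix]
  rwa [e] at h
end

section
/- Let (R, m_R) be a local ring with depth(R) > 0, let N_1, ..., N_n be strongly Tor-independent R-modules, let N_i' be first syzygies, and let x ∈ m_R \ m_R^2 be an R-regular element. Set R̄ = R/xR. Then x is regular on ⊗_{i∈I} N_i' for every subset I, and the R̄-modules R̄ ⊗_R N_1', ..., R̄ ⊗_R N_n' are strongly Tor-independent over R̄. -/
universe u

open CategoryTheory

section aux
open TensorProduct

/-- Resolution data, as spliced short exact sequences `K (n+1) → P n → K n`. -/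
structure PRes (R : Type u) [CommRing R] where
  K : ℕ → ModuleCat.{u} R
  P : ℕ → ModuleCat.{u} R
  i : ∀ n, K (n+1) →ₗ[R] P n
  p : ∀ n, P n →ₗ[R] K n
  inj : ∀ n, Function.Injective (i n)
  exact : ∀ n, Function.Exact (i n) (p n)
  surj : ∀ n, Function.Surjective (p n)
  proj : ∀ n, Module.Projective R (P n)

namespace PRes
variable {R : Type u} [CommRing R]

noncomputable def d (S : PRes R) (n : ℕ) : S.P (n+1) ⟶ S.P n :=
  ModuleCat.ofHom (S.i n ∘ₗ S.p (n+1))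

lemma d_apply (S : PRes R) (n : ℕ) (y : S.P (n+1)) : S.d n y = S.i n (S.p (n+1) y) := rfl

lemma d_d (S : PRes R) (n : ℕ) : S.d (n+1) ≫ S.d n = 0 := by
  ext y
  change S.i n (S.p (n+1) (S.i (n+1) (S.p (n+2) y))) = 0
  rw [(S.exact (n+1)).apply_apply_eq_zero, map_zero]

noncomputable def complex (S : PRes R) : ChainComplex (ModuleCat.{u} R) ℕ :=
  ChainComplex.of S.P S.d S.d_d

lemma complex_d (S : PRes R) (n : ℕ) : S.complex.d (n+1) n = S.d n :=
  ChainComplex.of_d _ _ _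

lemma exactAt_iff (F : ModuleCat.{u} R ⥤ ModuleCat.{u} R) [F.Additive]
    (S : PRes R) (n : ℕ) :
    ((F.mapHomologicalComplex _).obj S.complex).ExactAt (n+1) ↔
      ∀ y, F.map (S.d n) y = 0 → ∃ z, F.map (S.d (n+1)) z = y := by
  rw [HomologicalComplex.exactAt_iff' _ (n + 1 + 1) (n + 1) n (by simp) (by simp),
    ShortComplex.moduleCat_exact_iff]
  change (∀ y, F.map (S.complex.d (n+1) n) y = 0 → ∃ z, F.map (S.complex.d (n+2) (n+1)) z = y) ↔ _
  rw [complex_d, complex_d]; rfl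

lemma complex_exactAt (S : PRes R) (n : ℕ) : S.complex.ExactAt (n+1) := by
  rw [HomologicalComplex.exactAt_iff' _ (n + 1 + 1) (n + 1) n (by simp) (by simp),
    ShortComplex.moduleCat_exact_iff]
  change (∀ y, (S.complex.d (n+1) n) y = 0 → ∃ z, (S.complex.d (n+2) (n+1)) z = y)
  rw [complex_d, complex_d]
  intro (y : S.P (n+1)) (hy : S.i n (S.p (n+1) y) = 0)
  rw [map_eq_zero_iff _ (S.inj n)] at hy
  obtain ⟨w, hw⟩ := (S.exact (n+1) y).1 hy
  obtain ⟨z, hz⟩ := S.surj (n+2) w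
  exact ⟨z, show S.i (n+1) (S.p (n+2) z) = y by rw [hz, hw]⟩

noncomputable def π (S : PRes R) : S.complex ⟶ (ChainComplex.single₀ _).obj (S.K 0) :=
  (ChainComplex.toSingle₀Equiv _ _).symm ⟨(ModuleCat.ofHom (S.p 0) : S.P 0 ⟶ S.K 0), by
    rw [complex_d]
    ext (y : S.P 1)
    exact (S.exact 0).apply_apply_eq_zero _⟩

lemma quasiIso_π (S : PRes R) : QuasiIso S.π := ⟨fun n => by
    cases n
    · rw [ChainComplex.quasiIsoAt₀_iff, ShortComplex.quasiIso_iff_of_zeros']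
      · have h0 : S.π.f 0 = (ModuleCat.ofHom (S.p 0) : S.P 0 ⟶ S.K 0) :=
          ChainComplex.toSingle₀Equiv_symm_apply_f_zero _ _
        constructor
        · rw [ShortComplex.moduleCat_exact_iff]
          change ∀ y, (S.π.f 0) y = 0 → ∃ z, (S.complex.d 1 0) z = y
          rw [complex_d, h0]
          intro (y : S.P 0) (hy : S.p 0 y = 0)
          obtain ⟨w, hw⟩ := (S.exact 0 y).1 hy
          obtain ⟨z, hz⟩ := S.surj 1 w
          exact ⟨z, show S.i 0 (S.p 1 z) = y by rw [hz, hw]⟩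
        · change Epi (S.π.f 0)
          rw [h0]
          exact (ModuleCat.epi_iff_surjective _).2 (S.surj 0)
      all_goals rfl
    · rw [quasiIsoAt_iff_exactAt']
      · apply complex_exactAt
      · apply ChainComplex.exactAt_succ_single_obj⟩

noncomputable def toRes (S : PRes R) : ProjectiveResolution (S.K 0) where
  complex := S.complex
  projective n := by
    have := S.proj n
    exact (IsProjective.iff_projective (S.P n)).1 this
  π := S.π
  quasiIso := S.quasiIso_π

lemma tor_iff (S : PRes R) (T : ModuleCat.{u} R) (n : ℕ) :
    Limits.IsZero (((Tor (ModuleCat.{u} R) (n+1)).obj T).obj (S.K 0)) ↔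
      Function.Injective ((S.i n).lTensor T) := by
  have e := S.toRes.isoLeftDerivedObj ((MonoidalCategory.tensoringLeft _).obj T) (n+1)
  have h1 := e.isZero_iff
  refine h1.trans ?_
  refine (HomologicalComplex.exactAt_iff_isZero_homology _ _).symm.trans ?_
  refine (exactAt_iff _ S n).trans ?_
  change (∀ y : T ⊗[R] S.P (n+1), (S.i n ∘ₗ S.p (n+1)).lTensor T y = 0 →
    ∃ z : T ⊗[R] S.P (n+2), (S.i (n+1) ∘ₗ S.p (n+2)).lTensor T z = y) ↔ _
  simp only [LinearMap.lTensor_comp, LinearMap.comp_apply]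
  have ex := lTensor_exact T (S.exact (n+1)) (S.surj (n+1))
  rw [injective_iff_map_eq_zero]
  constructor
  · intro h a ha
    obtain ⟨y, rfl⟩ := LinearMap.lTensor_surjective T (S.surj (n+1)) a
    obtain ⟨z, rfl⟩ := h y ha
    exact ex.apply_apply_eq_zero _
  · intro h y hy
    obtain ⟨w, hw⟩ := (ex y).1 (h _ hy)
    obtain ⟨z, rfl⟩ := LinearMap.lTensor_surjective T (S.surj (n+2)) w
    exact ⟨z, hw⟩

noncomputable def syzIt (N : ModuleCat.{u} R) : ℕ → ModuleCat.{u} R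
  | 0 => N
  | n+1 => ModuleCat.of R (LinearMap.ker
      (Finsupp.linearCombination R (id : syzIt N n → syzIt N n)))

noncomputable def canon (N : ModuleCat.{u} R) : PRes R where
  K := syzIt N
  P n := ModuleCat.of R (syzIt N n →₀ R)
  i n := (LinearMap.ker (Finsupp.linearCombination R (id : syzIt N n → syzIt N n))).subtype
  p n := Finsupp.linearCombination R (id : syzIt N n → syzIt N n)
  inj n := Subtype.val_injective
  exact n := LinearMap.exact_subtype_ker_map _
  surj n := Finsupp.linearCombination_id_surjective _ _
  proj n := inferInstanceAs (Module.Projective R (syzIt N n →₀ R))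

noncomputable def cons (S : PRes R) (N F : ModuleCat.{u} R) (i : S.K 0 →ₗ[R] F) (p : F →ₗ[R] N)
    (hi : Function.Injective i) (he : Function.Exact i p) (hp : Function.Surjective p)
    (hF : Module.Projective R F) : PRes R where
  K n := match n with
    | 0 => N
    | n+1 => S.K n
  P n := match n with
    | 0 => F
    | n+1 => S.P n
  i n := match n with
    | 0 => i
    | n+1 => S.i n
  p n := match n with
    | 0 => p
    | n+1 => S.p n
  inj n := match n with
    | 0 => hi
    | n+1 => S.inj n
  exact n := match n with
    | 0 => he
    | n+1 => S.exact n
  surj n := match n with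
    | 0 => hp
    | n+1 => S.surj n
  proj n := match n with
    | 0 => hF
    | n+1 => S.proj n

end PRes

section chase
variable {R : Type*} [CommRing R] {A B C K P L : Type*}
  [AddCommGroup A] [AddCommGroup B] [AddCommGroup C] [AddCommGroup K] [AddCommGroup P]
  [AddCommGroup L] [Module R A] [Module R B] [Module R C] [Module R K] [Module R P] [Module R L]

lemma tor_chase {f : A →ₗ[R] B} {g : B →ₗ[R] C} {i : K →ₗ[R] P} {p : P →ₗ[R] L}
    (hf : Function.Injective f) (hfg : Function.Exact f g) (hg : Function.Surjective g)
    (hip : Function.Exact i p) (hp : Function.Surjective p) [Module.Flat R P]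
    (h : Function.Injective (i.lTensor C)) : Function.Injective (f.rTensor L) := by
  rw [injective_iff_map_eq_zero] at h ⊢
  intro a ha
  obtain ⟨a, rfl⟩ := LinearMap.lTensor_surjective A hp a
  rw [← LinearMap.comp_apply, LinearMap.rTensor_comp_lTensor, ← LinearMap.lTensor_comp_rTensor,
    LinearMap.comp_apply] at ha
  obtain ⟨b, hb⟩ := (lTensor_exact B hip hp _).1 ha
  have h1 : g.rTensor K b = 0 := by
    apply h
    rw [← LinearMap.comp_apply, LinearMap.lTensor_comp_rTensor, ← LinearMap.rTensor_comp_lTensor,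
      LinearMap.comp_apply, hb]
    exact (rTensor_exact P hfg hg).apply_apply_eq_zero _
  obtain ⟨c, rfl⟩ := (rTensor_exact K hfg hg _).1 h1
  have h2 : i.lTensor A c = a := by
    apply Module.Flat.rTensor_preserves_injective_linearMap (M := P) f hf
    rw [← hb, ← LinearMap.comp_apply, LinearMap.rTensor_comp_lTensor,
      ← LinearMap.lTensor_comp_rTensor, LinearMap.comp_apply]
  rw [← h2]
  exact (lTensor_exact A hip hp).apply_apply_eq_zero _

end chase

section families
variable {R : Type u} [CommRing R]

/-- All higher Tor vanish. -/
def TV (R : Type u) [CommRing R] (T N : ModuleCat.{u} R) : Prop :=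
  ∀ i : ℕ, 1 ≤ i → Limits.IsZero (((Tor (ModuleCat.{u} R) i).obj T).obj N)

lemma PRes.tv_iff (S : PRes R) (T : ModuleCat.{u} R) :
    TV R T (S.K 0) ↔ ∀ n, Function.Injective ((S.i n).lTensor T) := by
  constructor
  · intro h n
    exact (S.tor_iff T n).1 (h (n+1) (by omega))
  · intro h i hi
    obtain ⟨n, rfl⟩ : ∃ n, i = n + 1 := ⟨i - 1, by omega⟩
    exact (S.tor_iff T n).2 (h n)

lemma TV.of_flat (T N : ModuleCat.{u} R) [Module.Flat R T] : TV R T N :=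
  ((PRes.canon N).tv_iff T).2 fun n =>
    Module.Flat.lTensor_preserves_injective_linearMap _ ((PRes.canon N).inj n)

lemma TV.congr {T T' N : ModuleCat.{u} R} (e : T ≃ₗ[R] T') (h : TV R T N) : TV R T' N := by
  intro i hi
  exact (h i hi).of_iso (((Tor (ModuleCat.{u} R) i).mapIso e.toModuleIso.symm).app N)

lemma TV.of_ses {A B C N : ModuleCat.{u} R} (f : A →ₗ[R] B) (g : B →ₗ[R] C)
    (hf : Function.Injective f) (hfg : Function.Exact f g) (hg : Function.Surjective g)
    (hB : TV R B N) (hC : TV R C N) : TV R A N := by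
  let S := PRes.canon N
  have hB := (S.tv_iff B).1 hB
  have hC := (S.tv_iff C).1 hC
  refine (S.tv_iff A).2 fun n => ?_
  have := S.proj (n+1)
  have h1 := tor_chase hf hfg hg (S.exact (n+1)) (S.surj (n+1)) (hC (n+1))
  have h2 : Function.Injective (f.rTensor (S.P n) ∘ₗ (S.i n).lTensor A) := by
    rw [LinearMap.rTensor_comp_lTensor, ← LinearMap.lTensor_comp_rTensor]
    exact (hB n).comp h1
  exact Function.Injective.of_comp (f := f.rTensor (S.P n)) h2

/-- `A` is a first syzygy of `C`. -/
def IsSyz (A C : ModuleCat.{u} R) : Prop :=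
  ∃ (F : ModuleCat.{u} R) (i : A →ₗ[R] F) (p : F →ₗ[R] C), Function.Injective i ∧
    Function.Exact i p ∧ Function.Surjective p ∧ Module.Projective R F

lemma TV.inj {T A F C : ModuleCat.{u} R} (i : A →ₗ[R] F) (p : F →ₗ[R] C)
    (hi : Function.Injective i) (he : Function.Exact i p) (hp : Function.Surjective p)
    (hF : Module.Projective R F) (h : TV R T C) : Function.Injective (i.lTensor T) :=
  (((PRes.canon A).cons C F i p hi he hp hF).tv_iff T).1 h 0

lemma TV.syz_right {T A C : ModuleCat.{u} R} (hs : IsSyz A C) (h : TV R T C) : TV R T A := by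
  obtain ⟨F, i, p, hi, he, hp, hF⟩ := hs
  refine ((PRes.canon A).tv_iff T).2 fun n => ?_
  exact (((PRes.canon A).cons C F i p hi he hp hF).tv_iff T).1 h (n+1)

lemma TV.syz_left {T A C N : ModuleCat.{u} R} (hs : IsSyz A C) (hTC : TV R T C) (hTN : TV R T N)
    (h : TV R (ModuleCat.of R (C ⊗[R] T)) N) : TV R (ModuleCat.of R (A ⊗[R] T)) N := by
  obtain ⟨F, i, p, hi, he, hp, hF⟩ := hs
  have h1 : Function.Injective (i.rTensor T) :=
    (LinearMap.lTensor_inj_iff_rTensor_inj _ _).1 (hTC.inj i p hi he hp hF)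
  refine TV.of_ses (A := ModuleCat.of R (A ⊗[R] T)) (B := ModuleCat.of R (F ⊗[R] T))
    (C := ModuleCat.of R (C ⊗[R] T)) (i.rTensor T) (p.rTensor T) h1 (rTensor_exact T he hp)
    (LinearMap.rTensor_surjective T hp) ?_ h
  let S := PRes.canon N
  refine (S.tv_iff _).2 fun n => ?_
  have h2 := (S.tv_iff _).1 hTN n
  change Function.Injective ((S.i n).lTensor (F ⊗[R] T))
  rw [LinearMap.lTensor_tensor]
  have h3 := Module.Flat.lTensor_preserves_injective_linearMap (M := F) _ h2
  simpa using h3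

variable {n : ℕ}

lemma tensorList_congr {M M' : Fin n → ModuleCat.{u} R} (l : List (Fin n))
    (h : ∀ j ∈ l, M j = M' j) : tensorList R M l = tensorList R M' l := by
  induction l with
  | nil => rfl
  | cons a l ih =>
    simp only [tensorList]
    rw [h a (by simp), ih fun j hj => h j (by simp [hj])]

lemma tensorList_erase (M : Fin n → ModuleCat.{u} R) (k : Fin n) (l : List (Fin n)) (hk : k ∈ l) :
    Nonempty (tensorList R M l ≃ₗ[R] (M k ⊗[R] tensorList R M (l.erase k))) := by
  induction l with
  | nil => simp at hk
  | cons a l ih =>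
    by_cases h : a = k
    · subst h
      rw [List.erase_cons_head]
      exact ⟨LinearEquiv.refl R _⟩
    · obtain ⟨e⟩ := ih (by simpa [Ne.symm h] using hk)
      rw [List.erase_cons_tail (by simpa using h)]
      exact ⟨(TensorProduct.congr (LinearEquiv.refl R (M a)) e).trans
        (TensorProduct.leftComm R (M a) (M k) (tensorList R M (l.erase k)))⟩

lemma StronglyTorIndependent.tv {M : Fin n → ModuleCat.{u} R} (h : StronglyTorIndependent R M)
    {l : List (Fin n)} (hl : l.Nodup) {j : Fin n} (hj : j ∉ l) : TV R (tensorList R M l) (M j) := by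
  by_cases h0 : l = []
  · subst h0
    have : Module.Flat R (tensorList R M []) := inferInstanceAs (Module.Flat R R)
    exact TV.of_flat _ _
  · exact h l hl h0 j hj

lemma StronglyTorIndependent.replace {M M' : Fin n → ModuleCat.{u} R} (k : Fin n)
    (h : StronglyTorIndependent R M) (hoff : ∀ j, j ≠ k → M' j = M j) (hs : IsSyz (M' k) (M k)) :
    StronglyTorIndependent R M' := by
  intro l hl _ j hj
  change TV R (tensorList R M' l) (M' j)
  by_cases hk : k ∈ l
  · have hjk : j ≠ k := by rintro rfl; exact hj hk
    rw [hoff j hjk]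
    obtain ⟨e'⟩ := tensorList_erase M' k l hk
    obtain ⟨e⟩ := tensorList_erase M k l hk
    have hke : k ∉ l.erase k := hl.not_mem_erase
    have hje : j ∉ l.erase k := fun h => hj (List.mem_of_mem_erase h)
    have hle : (l.erase k).Nodup := hl.erase k
    rw [tensorList_congr (M := M') (M' := M) (l.erase k)
      (fun i hi => hoff i (by rintro rfl; exact hke hi))] at e'
    refine TV.congr (T := ModuleCat.of R (M' k ⊗[R] tensorList R M (l.erase k))) e'.symm ?_
    exact TV.syz_left hs (h.tv hle hke) (h.tv hle hje)
      (TV.congr (T' := ModuleCat.of R (M k ⊗[R] tensorList R M (l.erase k))) e (h.tv hl hj))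
  · rw [tensorList_congr (M := M') (M' := M) l (fun i hi => hoff i (by rintro rfl; exact hk hi))]
    by_cases hjk : j = k
    · subst hjk
      exact (h.tv hl hj).syz_right hs
    · rw [hoff j hjk]
      exact h.tv hl hj

open Classical in
/-- The mixed family. -/
noncomputable def mixed (N N' : Fin n → ModuleCat.{u} R) (s : Finset (Fin n)) :
    Fin n → ModuleCat.{u} R := fun j => if j ∈ s then N' j else N j

lemma StronglyTorIndependent.mixed {N N' : Fin n → ModuleCat.{u} R}
    (h : StronglyTorIndependent R N) (hs : ∀ j, IsSyz (N' j) (N j)) (s : Finset (Fin n)) :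
    StronglyTorIndependent R (mixed N N' s) := by
  classical
  induction s using Finset.induction_on with
  | empty => 
    have : _root_.mixed N N' ∅ = N := by funext j; simp [_root_.mixed]
    rwa [this]
  | insert a s ha ih =>
    refine ih.replace a ?_ ?_
    · intro j hj
      simp [_root_.mixed, hj]
    · simpa [_root_.mixed, ha] using hs a

lemma regular_tensorList {N N' : Fin n → ModuleCat.{u} R}
    (h : StronglyTorIndependent R N) (hs : ∀ j, IsSyz (N' j) (N j)) {x : R}
    (hx : IsSMulRegular R x) (l : List (Fin n)) (hl : l.Nodup) :
    IsSMulRegular (tensorList R N' l) x := by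
  classical
  induction l with
  | nil => exact hx
  | cons j l ih =>
    obtain ⟨hj, hl⟩ := List.nodup_cons.1 hl
    have h1 := (h.mixed hs (Finset.univ.erase j)).tv hl hj
    rw [tensorList_congr (M' := N') l] at h1
    · have h2 : mixed N N' (Finset.univ.erase j) j = N j := by simp [_root_.mixed]
      rw [h2] at h1
      obtain ⟨F, i, p, hi, he, hp, hF⟩ := hs j
      have h3 := (LinearMap.lTensor_inj_iff_rTensor_inj _ _).1 (h1.inj i p hi he hp hF)
      have h4 : IsSMulRegular (F ⊗[R] tensorList R N' l) x :=
        IsSMulRegular.lTensor F (ih hl)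
      exact h4.of_injective _ h3
    · intro i hi
      have : i ≠ j := by rintro rfl; exact hj hi
      simp [_root_.mixed, this]

lemma tensorList_baseChange (A : Type u) [CommRing A] [Algebra R A]
    (M : Fin n → ModuleCat.{u} R) (l : List (Fin n)) :
    Nonempty ((A ⊗[R] tensorList R M l) ≃ₗ[A]
      tensorList A (fun i => ModuleCat.of A (A ⊗[R] M i)) l) := by
  induction l with
  | nil => exact ⟨TensorProduct.AlgebraTensorModule.rid R A A⟩
  | cons j l ih =>
    obtain ⟨e⟩ := ih
    exact ⟨(TensorProduct.AlgebraTensorModule.distribBaseChange R A (M j)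
      (tensorList R M l)).trans
      (TensorProduct.congr (LinearEquiv.refl A (A ⊗[R] M j)) e)⟩

lemma quot_lTensor_injective {x : R} (hx : IsSMulRegular R x) {A B C : Type u}
    [AddCommGroup A] [AddCommGroup B] [AddCommGroup C] [Module R A] [Module R B] [Module R C]
    {f : A →ₗ[R] B} {g : B →ₗ[R] C} (hf : Function.Injective f) (hfg : Function.Exact f g)
    (hg : Function.Surjective g) (hC : IsSMulRegular C x) :
    Function.Injective (f.lTensor (R ⧸ Ideal.span {x})) := by
  rw [LinearMap.lTensor_inj_iff_rTensor_inj]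
  refine tor_chase (i := LinearMap.lsmul R R x) (p := (Ideal.span {x}).mkQ) hf hfg hg ?_
    (Submodule.mkQ_surjective _) ?_
  · intro y
    rw [← LinearMap.mem_ker, Submodule.ker_mkQ, Ideal.mem_span_singleton]
    exact ⟨fun ⟨z, hz⟩ => ⟨z, hz.symm⟩, fun ⟨z, hz⟩ => ⟨z, hz.symm⟩⟩
  · have : (LinearMap.lsmul R R x).lTensor C =
        (LinearMap.lsmul R (C ⊗[R] R) x) := by
      ext c
      simp [TensorProduct.smul_tmul']
      rw [TensorProduct.smul_tmul, smul_eq_mul, mul_one]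
    rw [this]
    exact ((TensorProduct.rid R C).isSMulRegular_congr x).2 hC

/-- Reduction of a resolution modulo a regular element. -/
noncomputable def PRes.red (S : PRes R) {x : R} (hx : IsSMulRegular R x)
    (h : ∀ n, IsSMulRegular (S.K n) x) : PRes (R ⧸ Ideal.span {x}) where
  K n := ModuleCat.of _ ((R ⧸ Ideal.span {x}) ⊗[R] S.K n)
  P n := ModuleCat.of _ ((R ⧸ Ideal.span {x}) ⊗[R] S.P n)
  i n := (S.i n).baseChange _
  p n := (S.p n).baseChange _
  inj n := quot_lTensor_injective hx (S.inj n) (S.exact n) (S.surj n) (h n)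
  exact n := lTensor_exact (R ⧸ Ideal.span {x}) (S.exact n) (S.surj n)
  surj n := LinearMap.lTensor_surjective (R ⧸ Ideal.span {x}) (S.surj n)
  proj n := by
    have := S.proj n
    exact inferInstanceAs (Module.Projective (R ⧸ Ideal.span {x})
      ((R ⧸ Ideal.span {x}) ⊗[R] S.P n))

lemma baseChange_lTensor_injective (A : Type u) [CommRing A] [Algebra R A] {T K P : Type u}
    [AddCommGroup T] [AddCommGroup K] [AddCommGroup P] [Module R T] [Module R K] [Module R P]
    (i : K →ₗ[R] P) (h : Function.Injective ((i.lTensor T).lTensor A)) :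
    Function.Injective ((i.baseChange A).lTensor (A ⊗[R] T)) := by
  have h3 : (i.baseChange A).lTensor (A ⊗[R] T) ∘ₗ
      (TensorProduct.AlgebraTensorModule.distribBaseChange R A T K).toLinearMap =
      (TensorProduct.AlgebraTensorModule.distribBaseChange R A T P).toLinearMap ∘ₗ
        (i.lTensor T).baseChange A := by
    ext t k
    simp
  have h4 : Function.Injective ((i.baseChange A).lTensor (A ⊗[R] T) ∘ₗ
      (TensorProduct.AlgebraTensorModule.distribBaseChange R A T K).toLinearMap) := by
    rw [h3]
    exact (TensorProduct.AlgebraTensorModule.distribBaseChange R A T P).injective.comp h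
  intro a b hab
  obtain ⟨a, rfl⟩ := (TensorProduct.AlgebraTensorModule.distribBaseChange R A T K).surjective a
  obtain ⟨b, rfl⟩ := (TensorProduct.AlgebraTensorModule.distribBaseChange R A T K).surjective b
  rw [h4 hab]

lemma TV.red {T N : ModuleCat.{u} R} (h : TV R T N) {x : R} (hx : IsSMulRegular R x)
    (hT : IsSMulRegular T x) (hN : IsSMulRegular N x) (hTN : IsSMulRegular (T ⊗[R] N) x) :
    TV (R ⧸ Ideal.span {x}) (ModuleCat.of _ ((R ⧸ Ideal.span {x}) ⊗[R] T))
      (ModuleCat.of _ ((R ⧸ Ideal.span {x}) ⊗[R] N)) := by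
  let S := PRes.canon N
  have h1 := (S.tv_iff T).1 h
  have hP : ∀ n, IsSMulRegular (S.P n) x := fun n => by
    have := S.proj n
    exact ((TensorProduct.rid R _).isSMulRegular_congr x).1 (IsSMulRegular.lTensor (S.P n) hx)
  have hK : ∀ n, IsSMulRegular (S.K n) x := by
    intro n
    cases n with
    | zero => exact hN
    | succ n => exact (hP n).of_injective _ (S.inj n)
  have hTK : ∀ n, IsSMulRegular (T ⊗[R] S.K n) x := by
    intro n
    cases n with
    | zero => exact hTN
    | succ n =>
      have := S.proj n
      exact (IsSMulRegular.rTensor (S.P n) hT).of_injective _ (h1 n)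
  refine ((S.red hx hK).tv_iff _).2 fun n => ?_
  have h2 := quot_lTensor_injective hx (h1 n) (lTensor_exact T (S.exact n) (S.surj n))
    (LinearMap.lTensor_surjective T (S.surj n)) (hTK n)
  exact baseChange_lTensor_injective _ _ h2

end families

end aux

open TensorProduct in
/-- Let `(R, m_R)` be a local ring with `depth R > 0`, let
`N 0, …, N (n-1)` be strongly Tor-independent finitely generated `R`-modules with first
syzygies `N' i`, and let `x ∈ m_R \ m_R²` be `R`-regular.  Set `R̄ = R/xR`.  Then `x`
is regular on every sub-tensor-product `⊗_{i ∈ I} N' i`, and the `R̄`-modules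
`R̄ ⊗_R N' i` are strongly Tor-independent over `R̄`. -/
theorem stmt15 (R : Type u) [CommRing R] [IsNoetherianRing R] [IsLocalRing R]
    (hdepth : 0 < ringDepth R)
    (n : ℕ) (N : Fin n → ModuleCat.{u} R)
    (hfg : ∀ i, Module.Finite R (N i))
    (hTI : StronglyTorIndependent R N)
    (c : Fin n → ℕ) (φ : ∀ i, (Fin (c i) → R) →ₗ[R] N i)
    (hφ : ∀ i, Function.Surjective (φ i))
    (x : R) (hx : x ∈ IsLocalRing.maximalIdeal R)
    (hx2 : x ∉ IsLocalRing.maximalIdeal R ^ 2)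
    (hreg : IsSMulRegular R x) :
    (∀ l : List (Fin n), l.Nodup →
      IsSMulRegular
        (tensorList R (fun i => ModuleCat.of R (LinearMap.ker (φ i))) l) x) ∧
    StronglyTorIndependent (R ⧸ Ideal.span {x})
      (fun i => ModuleCat.of (R ⧸ Ideal.span {x})
        ((R ⧸ Ideal.span {x}) ⊗[R] LinearMap.ker (φ i))) := by
  have hs : ∀ j, IsSyz (ModuleCat.of R (LinearMap.ker (φ j))) (N j) := fun j =>
    ⟨ModuleCat.of R (Fin (c j) → R), (LinearMap.ker (φ j)).subtype, φ j,
      Subtype.val_injective, LinearMap.exact_subtype_ker_map _, hφ j,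
      inferInstanceAs (Module.Projective R (Fin (c j) → R))⟩
  have hr := fun l hl => regular_tensorList hTI hs hreg l hl
  refine ⟨hr, ?_⟩
  intro l hl _ j hj
  have hN' : StronglyTorIndependent R (fun i => ModuleCat.of R (LinearMap.ker (φ i))) := by
    have h := hTI.mixed hs Finset.univ
    have e : mixed N (fun i => ModuleCat.of R (LinearMap.ker (φ i))) Finset.univ =
        (fun i => ModuleCat.of R (LinearMap.ker (φ i))) := by
      funext i; simp [mixed]
    rwa [e] at h
  obtain ⟨e⟩ := tensorList_baseChange (R ⧸ Ideal.span {x})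
    (fun i => ModuleCat.of R (LinearMap.ker (φ i))) l
  have hreg_j : IsSMulRegular (LinearMap.ker (φ j)) x :=
    ((TensorProduct.rid R _).isSMulRegular_congr x).1 (hr [j] (List.nodup_singleton j))
  have hreg_l := hr (j :: l) (List.nodup_cons.2 ⟨hj, hl⟩)
  have h1 := (hN'.tv hl hj).red hreg (hr l hl) hreg_j
    (((TensorProduct.comm R _ _).isSMulRegular_congr x).1 hreg_l)
  exact TV.congr (T := ModuleCat.of _ ((R ⧸ Ideal.span {x}) ⊗[R]
    tensorList R (fun i => ModuleCat.of R (LinearMap.ker (φ i))) l)) e h1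
end
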